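/- Let μ > 0, η > η̄, (β̃,γ̃) ∈ ℝ^p × ℝ^q, and set (β̂,γ̂) := S_{η,μ}(β̃,γ̃), H₁ := ∇²_{ββ}L(β̂,γ̂) + ηI_p, and C := ∇²_{γβ}L(β̂,γ̂). Then the Jacobian of the solution mapping satisfies the operator-norm bound ‖∇S_{η,μ}(β̃,γ̃)‖ ≤ (η/(η−η̄))·(1 + ‖H₁⁻¹C‖²), and moreover ‖H₁⁻¹C‖ ≤ η⁻¹ μ_min(Λ)⁻² σ_max(X) σ_max(Z)² ‖Xβ̂ − y‖, where X ∈ ℝ^{n×p} and y ∈ ℝ^n are the row-stacked matrices and vectors of the X_i and y_i (n = n_1+…+n_m), Λ := blockdiag(Λ_1,…,Λ_m), Z := blockdiag(Z_1,…,Z_m), μ_min(Λ) is the smallest eigenvalue of Λ, and σ_max denotes the largest singular value. -/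

import Mathlib

open Matrix Real Filter Topology Bornology
open scoped Pointwise

noncomputable section

abbrev Vec (k : ℕ) : Type := Fin k → ℝ

/-- Euclidean norm of a vector. -/
def eNorm {ι : Type*} [Fintype ι] (x : ι → ℝ) : ℝ := Real.sqrt (∑ j, (x j) ^ 2)

/-- Squared Euclidean norm of a pair of vectors. -/
def sqnorm2 {p q : ℕ} (w : Vec p × Vec q) : ℝ :=
  (∑ j, (w.1 j) ^ 2) + ∑ j, (w.2 j) ^ 2

/-- ℓ²→ℓ² operator norm of a matrix (its largest singular value). -/
def opNorm {ι κ : Type*} [Fintype ι] [Fintype κ] (M : Matrix ι κ ℝ) : ℝ :=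
  sInf {c : ℝ | 0 ≤ c ∧ ∀ x : κ → ℝ, eNorm (M.mulVec x) ≤ c * eNorm x}

/-- Smallest eigenvalue of a symmetric matrix, via Rayleigh quotients. -/
def minEig {ι : Type*} [Fintype ι] (M : Matrix ι ι ℝ) : ℝ :=
  sInf {r : ℝ | ∃ x : ι → ℝ, eNorm x = 1 ∧ r = x ⬝ᵥ M.mulVec x}

/-- Largest eigenvalue of a symmetric matrix, via Rayleigh quotients. -/
def maxEig {ι : Type*} [Fintype ι] (M : Matrix ι ι ℝ) : ℝ :=
  sSup {r : ℝ | ∃ x : ι → ℝ, eNorm x = 1 ∧ r = x ⬝ᵥ M.mulVec x}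

/-- The log-barrier (perspective of the negative log). -/
def phiBar (μ : ℝ) {q : ℕ} (γ : Vec q) : EReal :=
  if μ = 0 then (if ∀ j, 0 ≤ γ j then (0 : EReal) else ⊤)
  else if 0 < μ then
    (if ∀ j, 0 < γ j then (((-μ) * ∑ j, Real.log (γ j / μ) : ℝ) : EReal) else ⊤)
  else ⊤

/-- The coupling function κ_η. -/
def kappaFun (η : ℝ) {p q : ℕ} (w : Vec p × Vec q) : ℝ := η / 2 * sqnorm2 w

/-- 1-coercivity: liminf of F(w)/‖w‖ as ‖w‖ → ∞ is positive. -/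
def OneCoercive {p q : ℕ} (R : Vec p × Vec q → EReal) : Prop :=
  ∃ c : ℝ, 0 < c ∧ ∃ r : ℝ, ∀ w : Vec p × Vec q,
    r ≤ Real.sqrt (sqnorm2 w) → ((c * Real.sqrt (sqnorm2 w) : ℝ) : EReal) ≤ R w

/-- Data of a linear mixed-effects model. -/
structure LMEData (m p q : ℕ) where
  n : Fin m → ℕ
  X : ∀ i, Matrix (Fin (n i)) (Fin p) ℝ
  Z : ∀ i, Matrix (Fin (n i)) (Fin q) ℝ
  y : ∀ i, Fin (n i) → ℝ
  lam : ∀ i, Matrix (Fin (n i)) (Fin (n i)) ℝ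

namespace LMEData

variable {m p q : ℕ}

/-- Ω_i(Γ) = Z_i Γ Z_iᵀ + Λ_i. -/
def Omega (D : LMEData m p q) (Γ : Matrix (Fin q) (Fin q) ℝ) (i : Fin m) :
    Matrix (Fin (D.n i)) (Fin (D.n i)) ℝ :=
  D.Z i * Γ * (D.Z i)ᵀ + D.lam i

/-- The marginal negative log-likelihood L_ML(β, Γ). -/
def LML (D : LMEData m p q) (β : Vec p) (Γ : Matrix (Fin q) (Fin q) ℝ) : ℝ :=
  ∑ i, ((1 : ℝ) / 2 * ((D.y i - D.X i *ᵥ β) ⬝ᵥ ((D.Omega Γ i)⁻¹ *ᵥ (D.y i - D.X i *ᵥ β)))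
    + (1 : ℝ) / 2 * Real.log (D.Omega Γ i).det)

/-- L(β, γ) = L_ML(β, Diag γ). -/
def L (D : LMEData m p q) (β : Vec p) (γ : Vec q) : ℝ := D.LML β (Matrix.diagonal γ)

/-- ν = max_i (1/2) μ_min(Λ_i)^{-2} σ_max(Z_i)^4. -/
def nu (D : LMEData m p q) : ℝ :=
  ⨆ i : Fin m, (1 : ℝ) / 2 * ((minEig (D.lam i)) ^ 2)⁻¹ * (opNorm (D.Z i)) ^ 4

/-- η̄ = ν m. -/
def etabar (D : LMEData m p q) : ℝ := D.nu * m

/-- L_{η,μ}((β,γ),(β̃,γ̃)) = L(β,γ) + φ_μ(γ) + κ_η(β−β̃,γ−γ̃). -/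
def Lrelax (D : LMEData m p q) (η μ : ℝ) (x w : Vec p × Vec q) : EReal :=
  ((D.L x.1 x.2 + kappaFun η (x - w) : ℝ) : EReal) + phiBar μ x.2

/-- The optimal value function u_{η,μ} (with extended-real values). -/
def uval (D : LMEData m p q) (η μ : ℝ) (w : Vec p × Vec q) : EReal :=
  ⨅ x : Vec p × Vec q, D.Lrelax η μ x w

/-- The (real-valued) optimal value function u_{η,μ}. -/
def ufun (D : LMEData m p q) (η μ : ℝ) (w : Vec p × Vec q) : ℝ := (D.uval η μ w).toReal

/-- Partial gradient ∇_β L. -/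
def gradB (D : LMEData m p q) (β : Vec p) (γ : Vec q) : Vec p :=
  fun j => fderiv ℝ (fun b => D.L b γ) β (Pi.single j 1)

/-- Partial gradient ∇_γ L. -/
def gradG (D : LMEData m p q) (β : Vec p) (γ : Vec q) : Vec q :=
  fun j => fderiv ℝ (fun g => D.L β g) γ (Pi.single j 1)

/-- The map G_{η,μ}. -/
def Gmap (D : LMEData m p q) (η μ : ℝ) (x : Vec p × Vec q × Vec q) (w : Vec p × Vec q) :
    Vec p × Vec q × Vec q :=
  (D.gradB x.1 x.2.1 + η • (x.1 - w.1),
   D.gradG x.1 x.2.1 + η • (x.2.1 - w.2) - x.2.2,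
   fun j => x.2.2 j * x.2.1 j - μ)

/-- Second-derivative block ∇²_{ββ} L. -/
def hessBB (D : LMEData m p q) (β : Vec p) (γ : Vec q) : Matrix (Fin p) (Fin p) ℝ :=
  Matrix.of fun j k => fderiv ℝ (fun b => D.gradB b γ j) β (Pi.single k 1)

/-- Second-derivative block ∇²_{γγ} L. -/
def hessGG (D : LMEData m p q) (β : Vec p) (γ : Vec q) : Matrix (Fin q) (Fin q) ℝ :=
  Matrix.of fun j k => fderiv ℝ (fun g => D.gradG β g j) γ (Pi.single k 1)

/-- Second-derivative block ∇²_{γβ} L (the p×q cross block). -/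
def hessGB (D : LMEData m p q) (β : Vec p) (γ : Vec q) : Matrix (Fin p) (Fin q) ℝ :=
  Matrix.of fun j k => fderiv ℝ (fun g => D.gradB β g j) γ (Pi.single k 1)

/-- Second-derivative block ∇²_{βγ} L (the q×p cross block). -/
def hessBG (D : LMEData m p q) (β : Vec p) (γ : Vec q) : Matrix (Fin q) (Fin p) ℝ :=
  Matrix.of fun j k => fderiv ℝ (fun b => D.gradG b γ j) β (Pi.single k 1)

end LMEData

/-- f(r, M) = (1/2)(rᵀM⁻¹r + ln det M). -/
def fRM {n : ℕ} (r : Vec n) (M : Matrix (Fin n) (Fin n) ℝ) : ℝ :=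
  (1 : ℝ) / 2 * (r ⬝ᵥ (M⁻¹ *ᵥ r) + Real.log M.det)

section Helpers

variable {ι κ : Type*} [Fintype ι] [Fintype κ]

lemma eNorm_nonneg (x : ι → ℝ) : 0 ≤ eNorm x := Real.sqrt_nonneg _

lemma eNorm_sq (x : ι → ℝ) : eNorm x ^ 2 = x ⬝ᵥ x := by
  rw [eNorm, Real.sq_sqrt (Finset.sum_nonneg fun j _ => sq_nonneg _)]
  simp [dotProduct, sq]

lemma eNorm_sq' (x : ι → ℝ) : eNorm x ^ 2 = ∑ j, x j ^ 2 := by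
  rw [eNorm, Real.sq_sqrt (Finset.sum_nonneg fun j _ => sq_nonneg _)]

lemma dot_le_eNorm (x y : ι → ℝ) : x ⬝ᵥ y ≤ eNorm x * eNorm y := by
  apply le_of_sq_le_sq _ (mul_nonneg (eNorm_nonneg _) (eNorm_nonneg _))
  rw [mul_pow, eNorm_sq', eNorm_sq']
  exact Finset.sum_mul_sq_le_sq_mul_sq _ _ _

lemma eNorm_eq_zero {x : ι → ℝ} (h : eNorm x = 0) : x = 0 := by
  have := eNorm_sq x
  rw [h] at this
  exact dotProduct_self_eq_zero.mp (by simpa using this.symm)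

lemma eNorm_smul (c : ℝ) (x : ι → ℝ) : eNorm (c • x) = |c| * eNorm x := by
  rw [eNorm, eNorm, ← Real.sqrt_sq_eq_abs, ← Real.sqrt_mul (sq_nonneg _), Finset.mul_sum]
  simp [mul_pow]

lemma opNorm_set_nonempty (M : Matrix ι κ ℝ) :
    {c : ℝ | 0 ≤ c ∧ ∀ x : κ → ℝ, eNorm (M.mulVec x) ≤ c * eNorm x}.Nonempty := by
  refine ⟨Real.sqrt (∑ i, ∑ j, M i j ^ 2), Real.sqrt_nonneg _, fun x => ?_⟩
  have h0 : 0 ≤ ∑ i, ∑ j, M i j ^ 2 := by positivity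
  rw [eNorm, eNorm, ← Real.sqrt_mul h0]
  apply Real.sqrt_le_sqrt
  rw [Finset.sum_mul]
  exact Finset.sum_le_sum fun i _ => Finset.sum_mul_sq_le_sq_mul_sq _ _ _

lemma opNorm_nonneg (M : Matrix ι κ ℝ) : 0 ≤ opNorm M :=
  Real.sInf_nonneg fun _ h => h.1

lemma le_opNorm (M : Matrix ι κ ℝ) (x : κ → ℝ) : eNorm (M *ᵥ x) ≤ opNorm M * eNorm x := by
  rcases (eNorm_nonneg x).eq_or_lt with h | h
  · obtain ⟨c, hc⟩ := opNorm_set_nonempty M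
    have := hc.2 x
    rw [← h] at this ⊢
    simpa using this
  · rw [← div_le_iff₀ h]
    apply le_csInf (opNorm_set_nonempty M)
    intro c hc
    rw [div_le_iff₀ h]
    exact hc.2 x

lemma opNorm_le (M : Matrix ι κ ℝ) {c : ℝ} (hc : 0 ≤ c)
    (h : ∀ x : κ → ℝ, eNorm (M *ᵥ x) ≤ c * eNorm x) : opNorm M ≤ c :=
  csInf_le ⟨0, fun _ h => h.1⟩ ⟨hc, h⟩

lemma le_opNorm_transpose (M : Matrix ι κ ℝ) (x : ι → ℝ) :
    eNorm (Mᵀ *ᵥ x) ≤ opNorm M * eNorm x := by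
  rcases (eNorm_nonneg (Mᵀ *ᵥ x)).eq_or_lt with h | h
  · rw [← h]; exact mul_nonneg (opNorm_nonneg _) (eNorm_nonneg _)
  · have h1 : eNorm (Mᵀ *ᵥ x) ^ 2 = (M *ᵥ (Mᵀ *ᵥ x)) ⬝ᵥ x := by
      rw [eNorm_sq, dotProduct_comm (M *ᵥ _), dotProduct_mulVec x M, ← mulVec_transpose]
    have h2 := dot_le_eNorm (M *ᵥ (Mᵀ *ᵥ x)) x
    have h3 := mul_le_mul_of_nonneg_right (le_opNorm M (Mᵀ *ᵥ x)) (eNorm_nonneg x)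
    nlinarith

lemma posdef_factor [DecidableEq ι] {M : Matrix ι ι ℝ} (hM : M.PosDef) :
    ∃ B : Matrix ι ι ℝ, M = Bᵀ * B ∧ IsUnit B := by
  open scoped MatrixOrder Matrix.Norms.L2Operator in
  obtain ⟨B, hB⟩ := CStarAlgebra.nonneg_iff_eq_star_mul_self.mp hM.posSemidef.nonneg
  rw [star_eq_conjTranspose, conjTranspose_eq_transpose_of_trivial] at hB
  refine ⟨B, hB, ?_⟩
  rw [isUnit_iff_isUnit_det]
  have := hM.det_pos
  rw [hB, det_mul] at this
  exact isUnit_iff_ne_zero.mpr fun h => by simp [h] at this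

lemma posdef_dot_nonneg {M : Matrix ι ι ℝ} (hM : M.PosSemidef) (x : ι → ℝ) :
    0 ≤ x ⬝ᵥ M *ᵥ x := by
  simpa using hM.dotProduct_mulVec_nonneg x

lemma minEig_le {M : Matrix ι ι ℝ} (hM : M.PosSemidef) (x : ι → ℝ) :
    minEig M * eNorm x ^ 2 ≤ x ⬝ᵥ M *ᵥ x := by
  rcases (eNorm_nonneg x).eq_or_lt with h | h
  · rw [← h]; simpa using posdef_dot_nonneg hM x
  · have : minEig M ≤ (eNorm x)⁻¹ ^ 2 * (x ⬝ᵥ M *ᵥ x) := by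
      apply csInf_le
      · refine ⟨0, ?_⟩
        rintro r ⟨x, -, rfl⟩
        exact posdef_dot_nonneg hM x
      · refine ⟨(eNorm x)⁻¹ • x, ?_, ?_⟩
        · rw [eNorm_smul, abs_of_pos (inv_pos.mpr h), inv_mul_cancel₀ h.ne']
        · simp [mulVec_smul, sq, mul_assoc]
    rw [inv_pow, inv_mul_eq_div, le_div_iff₀ (by positivity)] at this
    exact this

lemma minEig_pos [DecidableEq ι] [Nonempty ι] {M : Matrix ι ι ℝ} (hM : M.PosDef) :
    0 < minEig M := by
  obtain ⟨B, hB, hu⟩ := posdef_factor hM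
  have key : ∀ x : ι → ℝ, eNorm x = 1 → ((opNorm B⁻¹) ^ 2 + 1)⁻¹ ≤ x ⬝ᵥ M *ᵥ x := by
    intro x hx
    have h1 : x ⬝ᵥ M *ᵥ x = eNorm (B *ᵥ x) ^ 2 := by
      rw [eNorm_sq, hB, ← mulVec_mulVec, dotProduct_mulVec, vecMul_transpose]
    have h2 := le_opNorm B⁻¹ (B *ᵥ x)
    rw [mulVec_mulVec, nonsing_inv_mul _ ((isUnit_iff_isUnit_det _).mp hu), one_mulVec, hx] at h2
    rw [h1, inv_le_iff_one_le_mul₀ (by positivity)]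
    have h3 := eNorm_nonneg (B *ᵥ x)
    nlinarith [mul_nonneg (opNorm_nonneg B⁻¹) h3]
  refine lt_of_lt_of_le (inv_pos.mpr (by positivity : 0 < (opNorm B⁻¹) ^ 2 + 1)) (le_csInf ?_ ?_)
  · obtain ⟨i⟩ := ‹Nonempty ι›
    refine ⟨_, Pi.single i 1, ?_, rfl⟩
    rw [eNorm]
    simp [Pi.single_apply]
  · rintro r ⟨x, hx, rfl⟩
    exact key x hx

lemma mulVec_inv_posdef [DecidableEq ι] {M : Matrix ι ι ℝ} (hM : M.PosDef) (x : ι → ℝ) :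
    M *ᵥ (M⁻¹ *ᵥ x) = x := by
  rw [mulVec_mulVec, mul_nonsing_inv _ ((isUnit_iff_isUnit_det _).mp hM.isUnit), one_mulVec]

/-- If `M ⪰ l I` then `‖M⁻¹x‖ ≤ l⁻¹‖x‖`. -/
lemma eNorm_inv_le [DecidableEq ι] {M : Matrix ι ι ℝ} (hM : M.PosDef) {l : ℝ} (hl : 0 < l)
    (h : ∀ x, l * eNorm x ^ 2 ≤ x ⬝ᵥ M *ᵥ x) (x : ι → ℝ) :
    eNorm (M⁻¹ *ᵥ x) ≤ l⁻¹ * eNorm x := by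
  have h1 := h (M⁻¹ *ᵥ x)
  rw [mulVec_inv_posdef hM] at h1
  have h2 := dot_le_eNorm (M⁻¹ *ᵥ x) x
  rw [inv_mul_eq_div, le_div_iff₀ hl]
  rcases (eNorm_nonneg (M⁻¹ *ᵥ x)).eq_or_lt with h0 | h0
  · rw [← h0, zero_mul]; exact eNorm_nonneg x
  · nlinarith

lemma symm_dot {M : Matrix ι ι ℝ} (hM : Mᵀ = M) (x y : ι → ℝ) :
    x ⬝ᵥ M *ᵥ y = y ⬝ᵥ M *ᵥ x := by
  rw [dotProduct_mulVec, ← mulVec_transpose, hM, dotProduct_comm]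

lemma quad_dual [DecidableEq ι] {M : Matrix ι ι ℝ} (hM : M.PosDef) (r v : ι → ℝ) :
    2 * (v ⬝ᵥ r) - v ⬝ᵥ M *ᵥ v ≤ r ⬝ᵥ M⁻¹ *ᵥ r := by
  have hs : Mᵀ = M := by
    have := hM.1.eq
    rwa [conjTranspose_eq_transpose_of_trivial] at this
  have h := posdef_dot_nonneg hM.posSemidef (v - M⁻¹ *ᵥ r)
  rw [mulVec_sub, mulVec_inv_posdef hM, sub_dotProduct, dotProduct_sub, dotProduct_sub,
    symm_dot hs (M⁻¹ *ᵥ r) v, mulVec_inv_posdef hM, dotProduct_comm (M⁻¹ *ᵥ r)] at h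
  linarith

lemma quad_eq [DecidableEq ι] {M : Matrix ι ι ℝ} (hM : M.PosDef) (r : ι → ℝ) :
    r ⬝ᵥ M⁻¹ *ᵥ r = 2 * ((M⁻¹ *ᵥ r) ⬝ᵥ r) - (M⁻¹ *ᵥ r) ⬝ᵥ M *ᵥ (M⁻¹ *ᵥ r) := by
  rw [mulVec_inv_posdef hM, dotProduct_comm (M⁻¹ *ᵥ r)]; ring

lemma quad_convex [DecidableEq ι] {M N P : Matrix ι ι ℝ} (hM : M.PosDef) (hN : N.PosDef)
    (hP : P.PosDef) (r r' : ι → ℝ) {t : ℝ} (ht0 : 0 ≤ t) (ht1 : t ≤ 1)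
    (hPe : P = (1 - t) • M + t • N) :
    ((1 - t) • r + t • r') ⬝ᵥ P⁻¹ *ᵥ ((1 - t) • r + t • r')
      ≤ (1 - t) * (r ⬝ᵥ M⁻¹ *ᵥ r) + t * (r' ⬝ᵥ N⁻¹ *ᵥ r') := by
  rw [quad_eq hP]
  set v := P⁻¹ *ᵥ ((1 - t) • r + t • r')
  have h1 := mul_le_mul_of_nonneg_left (quad_dual hM r v) (sub_nonneg.mpr ht1)
  have h2 := mul_le_mul_of_nonneg_left (quad_dual hN r' v) ht0
  rw [hPe]
  simp only [add_mulVec, smul_mulVec, dotProduct_add, dotProduct_smul, smul_eq_mul]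
  linarith

lemma logdet_le_trace [DecidableEq ι] {P : Matrix ι ι ℝ} (hP : P.PosDef) :
    Real.log P.det ≤ P.trace - Fintype.card ι := by
  rw [hP.1.det_eq_prod_eigenvalues, hP.1.trace_eq_sum_eigenvalues]
  simp only [RCLike.ofReal_real_eq_id, id]
  rw [Real.log_prod (fun i _ => (hP.eigenvalues_pos i).ne')]
  calc _ ≤ ∑ i, (hP.1.eigenvalues i - 1) :=
        Finset.sum_le_sum fun i _ => Real.log_le_sub_one_of_pos (hP.eigenvalues_pos i)
    _ = _ := by simp

lemma logdet_concave [DecidableEq ι] {M N : Matrix ι ι ℝ} (hM : M.PosDef) (hN : N.PosDef) :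
    Real.log N.det ≤ Real.log M.det + (M⁻¹ * (N - M)).trace := by
  obtain ⟨B, hB, hu⟩ := posdef_factor hM.inv
  have hP : (B * N * Bᵀ).PosDef := by
    have := hN.mul_mul_conjTranspose_same (B := B) (Matrix.vecMul_injective_iff_isUnit.mpr hu)
    simpa using this
  have h := logdet_le_trace hP
  have hdet : (B * N * Bᵀ).det = (M.det)⁻¹ * N.det := by
    have : M⁻¹.det = Bᵀ.det * B.det := by rw [hB, det_mul]
    rw [det_nonsing_inv, Ring.inverse_eq_inv'] at this
    rw [det_mul, det_mul, this]; ring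
  have htr : (B * N * Bᵀ).trace = (M⁻¹ * N).trace := by
    rw [trace_mul_cycle, ← hB]
  have hMM : M⁻¹ * M = 1 := nonsing_inv_mul _ ((isUnit_iff_isUnit_det _).mp hM.isUnit)
  rw [hdet, htr, Real.log_mul (inv_ne_zero hM.det_pos.ne') hN.det_pos.ne', Real.log_inv] at h
  rw [mul_sub, hMM, trace_sub, trace_one]
  linarith

end Helpers

section Omega

variable {ι κ : Type*} [Fintype ι] [Fintype κ] [DecidableEq ι] [DecidableEq κ]

lemma omega_posdef {Λ : Matrix ι ι ℝ} (hΛ : Λ.PosDef) (Z : Matrix ι κ ℝ) {g : κ → ℝ}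
    (hg : ∀ j, 0 ≤ g j) : (Z * Matrix.diagonal g * Zᵀ + Λ).PosDef := by
  have h : (Z * Matrix.diagonal g * Zᵀ).PosSemidef := by
    have := (PosSemidef.diagonal (d := g) hg).mul_mul_conjTranspose_same Z
    rwa [conjTranspose_eq_transpose_of_trivial] at this
  exact PosDef.posSemidef_add h hΛ

lemma omega_lower {Λ : Matrix ι ι ℝ} (hΛ : Λ.PosDef) (Z : Matrix ι κ ℝ) {g : κ → ℝ}
    (hg : ∀ j, 0 ≤ g j) {l : ℝ} (hl : ∀ x, l * eNorm x ^ 2 ≤ x ⬝ᵥ Λ *ᵥ x) (x : ι → ℝ) :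
    l * eNorm x ^ 2 ≤ x ⬝ᵥ (Z * Matrix.diagonal g * Zᵀ + Λ) *ᵥ x := by
  have h : (Z * Matrix.diagonal g * Zᵀ).PosSemidef := by
    have := (PosSemidef.diagonal (d := g) hg).mul_mul_conjTranspose_same Z
    rwa [conjTranspose_eq_transpose_of_trivial] at this
  rw [add_mulVec, dotProduct_add]
  have := posdef_dot_nonneg h x
  linarith [hl x]

lemma inv_quad_le {M : Matrix ι ι ℝ} (hM : M.PosDef) {l : ℝ} (hl : 0 < l)
    (h : ∀ x, l * eNorm x ^ 2 ≤ x ⬝ᵥ M *ᵥ x) (Z : Matrix ι κ ℝ) (v : κ → ℝ) :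
    (Z *ᵥ v) ⬝ᵥ M⁻¹ *ᵥ (Z *ᵥ v) ≤ l⁻¹ * opNorm Z ^ 2 * eNorm v ^ 2 := by
  have h1 := dot_le_eNorm (Z *ᵥ v) (M⁻¹ *ᵥ (Z *ᵥ v))
  have h2 := eNorm_inv_le hM hl h (Z *ᵥ v)
  have h3 := le_opNorm Z v
  have h4 := eNorm_nonneg (Z *ᵥ v)
  calc _ ≤ _ := h1
    _ ≤ eNorm (Z *ᵥ v) * (l⁻¹ * eNorm (Z *ᵥ v)) := by gcongr
    _ = l⁻¹ * eNorm (Z *ᵥ v) ^ 2 := by ring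
    _ ≤ l⁻¹ * (opNorm Z * eNorm v) ^ 2 := by gcongr
    _ = _ := by ring

lemma trace_bound {M N : Matrix ι ι ℝ} (hM : M.PosDef) (hN : N.PosDef) {l : ℝ} (hl : 0 < l)
    (h : ∀ x, l * eNorm x ^ 2 ≤ x ⬝ᵥ M *ᵥ x) (h' : ∀ x, l * eNorm x ^ 2 ≤ x ⬝ᵥ N *ᵥ x)
    (Z : Matrix ι κ ℝ) (d : κ → ℝ) :
    (M⁻¹ * (Z * diagonal d * Zᵀ) * N⁻¹ * (Z * diagonal d * Zᵀ)).trace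
      ≤ (l ^ 2)⁻¹ * opNorm Z ^ 4 * ∑ j, d j ^ 2 := by
  obtain ⟨B, hB, hu⟩ := posdef_factor hM.inv
  set R := B * Z with hR
  have e1 : (M⁻¹ * (Z * diagonal d * Zᵀ) * N⁻¹ * (Z * diagonal d * Zᵀ)).trace
      = ((R * diagonal d) * (Zᵀ * N⁻¹ * Z) * (R * diagonal d)ᵀ).trace := by
    rw [hB, hR, transpose_mul, transpose_mul, diagonal_transpose]
    rw [show Bᵀ * B * (Z * diagonal d * Zᵀ) * N⁻¹ * (Z * diagonal d * Zᵀ)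
      = Bᵀ * (B * (Z * diagonal d * Zᵀ) * N⁻¹ * (Z * diagonal d * Zᵀ)) by
        simp only [Matrix.mul_assoc], trace_mul_comm]
    simp only [Matrix.mul_assoc]
  have e2 : ∀ V : Matrix ι κ ℝ, (V * (Zᵀ * N⁻¹ * Z) * Vᵀ).trace
      = ∑ a, (Z *ᵥ (V a)) ⬝ᵥ N⁻¹ *ᵥ (Z *ᵥ (V a)) := by
    intro V
    rw [trace]
    refine Finset.sum_congr rfl fun a _ => ?_
    have : (V * (Zᵀ * N⁻¹ * Z) * Vᵀ) a a = V a ⬝ᵥ (Zᵀ * N⁻¹ * Z) *ᵥ (V a) := by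
      rw [Matrix.mul_assoc, mul_apply']
      congr 1
    rw [diag_apply, this, ← mulVec_mulVec, ← mulVec_mulVec, dotProduct_mulVec, vecMul_transpose]
  have e3 : ∑ a, eNorm ((R * diagonal d) a) ^ 2
      = ∑ j, d j ^ 2 * ((Z *ᵥ Pi.single j 1) ⬝ᵥ M⁻¹ *ᵥ (Z *ᵥ Pi.single j 1)) := by
    simp only [eNorm_sq']
    rw [Finset.sum_comm]
    refine Finset.sum_congr rfl fun j _ => ?_
    rw [hB, ← mulVec_mulVec, dotProduct_mulVec, vecMul_transpose, mulVec_mulVec, ← hR, ← eNorm_sq,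
      eNorm_sq', Finset.mul_sum]
    refine Finset.sum_congr rfl fun a _ => ?_
    rw [mul_diagonal]
    simp
    ring
  rw [e1, e2]
  calc _ ≤ ∑ a, l⁻¹ * opNorm Z ^ 2 * eNorm ((R * diagonal d) a) ^ 2 :=
        Finset.sum_le_sum fun a _ => inv_quad_le hN hl h' Z _
    _ = l⁻¹ * opNorm Z ^ 2 *
          ∑ j, d j ^ 2 * ((Z *ᵥ Pi.single j 1) ⬝ᵥ M⁻¹ *ᵥ (Z *ᵥ Pi.single j 1)) := by
        rw [← Finset.mul_sum, e3]
    _ ≤ l⁻¹ * opNorm Z ^ 2 * ∑ j, d j ^ 2 * (l⁻¹ * opNorm Z ^ 2) := by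
        gcongr with j
        have h5 := inv_quad_le hM hl h Z (Pi.single j 1)
        have h6 : eNorm (Pi.single j (1:ℝ) : κ → ℝ) ^ 2 = 1 := by
          rw [eNorm_sq']; simp [Pi.single_apply]
        rwa [h6, mul_one] at h5
    _ = _ := by
        rw [← Finset.sum_mul]; ring

/-- One block of the likelihood. -/
def blockL (Λ : Matrix ι ι ℝ) (Z : Matrix ι κ ℝ) (r : ι → ℝ) (g : κ → ℝ) : ℝ :=
  (1 : ℝ) / 2 * (r ⬝ᵥ ((Z * diagonal g * Zᵀ + Λ)⁻¹ *ᵥ r))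
    + (1 : ℝ) / 2 * Real.log (Z * diagonal g * Zᵀ + Λ).det

lemma blockL_semiconvex [Nonempty ι] {Λ : Matrix ι ι ℝ} (hΛ : Λ.PosDef) (Z : Matrix ι κ ℝ)
    (r r' : ι → ℝ) {g g' : κ → ℝ} (hg : ∀ j, 0 ≤ g j) (hg' : ∀ j, 0 ≤ g' j)
    {t : ℝ} (ht0 : 0 ≤ t) (ht1 : t ≤ 1) :
    blockL Λ Z ((1 - t) • r + t • r') ((1 - t) • g + t • g')
      + blockL Λ Z ((1 - t) • r' + t • r) ((1 - t) • g' + t • g)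
    ≤ blockL Λ Z r g + blockL Λ Z r' g'
      + t * ((1 : ℝ) / 2 * ((minEig Λ) ^ 2)⁻¹ * opNorm Z ^ 4) * ∑ j, (g' j - g j) ^ 2 := by
  have hc : ∀ (a b : κ → ℝ), (∀ j, 0 ≤ a j) → (∀ j, 0 ≤ b j) → ∀ j, 0 ≤ ((1 - t) • a + t • b) j := by
    intro a b ha hb j
    exact add_nonneg (mul_nonneg (sub_nonneg.mpr ht1) (ha j)) (mul_nonneg ht0 (hb j))
  have hcomb : ∀ a b : κ → ℝ, Z * diagonal ((1 - t) • a + t • b) * Zᵀ + Λ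
      = (1 - t) • (Z * diagonal a * Zᵀ + Λ) + t • (Z * diagonal b * Zᵀ + Λ) := by
    intro a b
    have e : diagonal ((1 - t) • a + t • b) = (1 - t) • diagonal a + t • diagonal b := by
      rw [← diagonal_smul, ← diagonal_smul, diagonal_add]; rfl
    rw [e]
    simp only [Matrix.mul_add, Matrix.add_mul, Matrix.mul_smul, Matrix.smul_mul]
    module
  have hM := omega_posdef hΛ Z hg
  have hN := omega_posdef hΛ Z hg'
  have hP := omega_posdef hΛ Z (hc g g' hg hg')
  have hQ := omega_posdef hΛ Z (hc g' g hg' hg)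
  have hlpos := minEig_pos hΛ
  have hl1 := omega_lower hΛ Z hg (minEig_le hΛ.posSemidef)
  have hl2 := omega_lower hΛ Z hg' (minEig_le hΛ.posSemidef)
  have q1 := quad_convex hM hN hP r r' ht0 ht1 (hcomb g g')
  have q2 := quad_convex hN hM hQ r' r ht0 ht1 (hcomb g' g)
  have l1 := logdet_concave hM hP
  have l2 := logdet_concave hN hQ
  have hdiff : (Z * diagonal g' * Zᵀ + Λ) - (Z * diagonal g * Zᵀ + Λ)
      = Z * diagonal (g' - g) * Zᵀ := by
    have e : diagonal (g' - g) = diagonal g' - diagonal g := by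
      rw [diagonal_sub]; rfl
    rw [e]
    simp only [Matrix.mul_sub, Matrix.sub_mul]
    abel
  have tb := trace_bound hM hN hlpos hl1 hl2 Z (g' - g)
  rw [← hdiff] at tb
  unfold blockL
  have d1 := hcomb g g'
  have d2 := hcomb g' g
  set M := Z * diagonal g * Zᵀ + Λ
  set N := Z * diagonal g' * Zᵀ + Λ
  set P := Z * diagonal ((1 - t) • g + t • g') * Zᵀ + Λ
  set Q := Z * diagonal ((1 - t) • g' + t • g) * Zᵀ + Λ
  have hMM : M⁻¹ * M = 1 := nonsing_inv_mul _ ((isUnit_iff_isUnit_det _).mp hM.isUnit)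
  have hNN : N * N⁻¹ = 1 := mul_nonsing_inv _ ((isUnit_iff_isUnit_det _).mp hN.isUnit)
  have t1 : (M⁻¹ * (P - M)).trace = t * (M⁻¹ * (N - M)).trace := by
    rw [show P - M = t • (N - M) by rw [d1]; module, Matrix.mul_smul, trace_smul, smul_eq_mul]
  have t2 : (N⁻¹ * (Q - N)).trace = - (t * (N⁻¹ * (N - M)).trace) := by
    rw [show Q - N = (-t) • (N - M) by rw [d2]; module, Matrix.mul_smul, trace_smul, smul_eq_mul]
    ring
  have t3 : (M⁻¹ * (N - M)).trace - (N⁻¹ * (N - M)).trace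
      = (M⁻¹ * (N - M) * N⁻¹ * (N - M)).trace := by
    rw [Matrix.mul_sub M⁻¹ N M, hMM, Matrix.sub_mul (M⁻¹ * N), Matrix.mul_assoc M⁻¹, hNN,
      Matrix.mul_one, Matrix.one_mul, Matrix.sub_mul, trace_sub]
    simp only [trace_sub]
    rw [Matrix.mul_sub M⁻¹ N M, hMM, trace_sub]
  have tb' := mul_le_mul_of_nonneg_left tb ht0
  rw [← t3] at tb'
  simp only [Pi.sub_apply] at tb'
  rw [t1] at l1
  rw [t2] at l2
  linarith

end Omega

lemma LMEData.L_semiconvex {m p q : ℕ} (D : LMEData m p q) (hn : ∀ i, 0 < D.n i)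
    (hlam : ∀ i, (D.lam i).PosDef) (b b' : Vec p) {g g' : Vec q} (hg : ∀ j, 0 ≤ g j)
    (hg' : ∀ j, 0 ≤ g' j) {t : ℝ} (ht0 : 0 ≤ t) (ht1 : t ≤ 1) :
    D.L ((1 - t) • b + t • b') ((1 - t) • g + t • g')
      + D.L ((1 - t) • b' + t • b) ((1 - t) • g' + t • g)
    ≤ D.L b g + D.L b' g' + t * D.etabar * ∑ j, (g' j - g j) ^ 2 := by
  have hL : ∀ b g, D.L b g = ∑ i, blockL (D.lam i) (D.Z i) (D.y i - D.X i *ᵥ b) g :=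
    fun b g => rfl
  have hr : ∀ i (b b' : Vec p), D.y i - D.X i *ᵥ ((1 - t) • b + t • b')
      = (1 - t) • (D.y i - D.X i *ᵥ b) + t • (D.y i - D.X i *ᵥ b') := by
    intro i b b'
    rw [mulVec_add, mulVec_smul, mulVec_smul]
    module
  have hnu : ∀ i, (1 : ℝ) / 2 * ((minEig (D.lam i)) ^ 2)⁻¹ * (opNorm (D.Z i)) ^ 4 ≤ D.nu :=
    fun i => le_ciSup (f := fun i : Fin m => (1 : ℝ) / 2 * ((minEig (D.lam i)) ^ 2)⁻¹
      * (opNorm (D.Z i)) ^ 4) (Set.finite_range _).bddAbove i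
  rw [hL, hL, hL, hL]
  have h0 : 0 ≤ ∑ j, (g' j - g j) ^ 2 := Finset.sum_nonneg fun j _ => sq_nonneg _
  calc _ = ∑ i, (blockL (D.lam i) (D.Z i) ((1 - t) • (D.y i - D.X i *ᵥ b) + t • (D.y i - D.X i *ᵥ b'))
          ((1 - t) • g + t • g')
        + blockL (D.lam i) (D.Z i) ((1 - t) • (D.y i - D.X i *ᵥ b') + t • (D.y i - D.X i *ᵥ b))
          ((1 - t) • g' + t • g)) := by
        rw [Finset.sum_add_distrib]; simp only [hr]
    _ ≤ ∑ i, (blockL (D.lam i) (D.Z i) (D.y i - D.X i *ᵥ b) g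
          + blockL (D.lam i) (D.Z i) (D.y i - D.X i *ᵥ b') g'
          + t * D.nu * ∑ j, (g' j - g j) ^ 2) := by
        refine Finset.sum_le_sum fun i _ => ?_
        have : Nonempty (Fin (D.n i)) := ⟨⟨0, hn i⟩⟩
        refine (blockL_semiconvex (hlam i) (D.Z i) _ _ hg hg' ht0 ht1).trans ?_
        gcongr
        exact hnu i
    _ = _ := by
        rw [Finset.sum_add_distrib, Finset.sum_add_distrib]
        simp only [Finset.sum_const, Finset.card_univ, Fintype.card_fin, nsmul_eq_mul,
          LMEData.etabar]
        ring

lemma LMEData.etabar_nonneg {m p q : ℕ} (D : LMEData m p q) : 0 ≤ D.etabar := by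
  refine mul_nonneg (Real.iSup_nonneg fun i => ?_) (Nat.cast_nonneg _)
  have := opNorm_nonneg (D.Z i)
  positivity

section Lipschitz

variable {m p q : ℕ}

lemma LMEData.Lrelax_eq (D : LMEData m p q) {η μ : ℝ} (hμ : 0 < μ) {x w : Vec p × Vec q}
    (hx : ∀ j, 0 < x.2 j) : D.Lrelax η μ x w
      = ((D.L x.1 x.2 + kappaFun η (x - w) + (-μ) * ∑ j, Real.log (x.2 j / μ) : ℝ) : EReal) := by
  rw [LMEData.Lrelax, phiBar, if_neg hμ.ne', if_pos hμ, if_pos hx, ← EReal.coe_add]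

lemma LMEData.S_pos (D : LMEData m p q) {η μ : ℝ} (hμ : 0 < μ) {x w : Vec p × Vec q}
    (hS : ∀ x' : Vec p × Vec q, D.Lrelax η μ x w ≤ D.Lrelax η μ x' w) : ∀ j, 0 < x.2 j := by
  by_contra hcon
  have h := hS (0, 1)
  rw [D.Lrelax_eq hμ (x := (0, 1)) (fun j => by simp)] at h
  rw [LMEData.Lrelax, phiBar, if_neg hμ.ne', if_pos hμ, if_neg hcon, EReal.coe_add_top] at h
  exact EReal.coe_ne_top _ (top_le_iff.mp h)

lemma log_div_concave {μ a b t : ℝ} (hμ : 0 < μ) (ha : 0 < a) (hb : 0 < b) (ht0 : 0 ≤ t)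
    (ht1 : t ≤ 1) :
    (1 - t) * Real.log (a / μ) + t * Real.log (b / μ) ≤ Real.log (((1 - t) * a + t * b) / μ) := by
  have h := strictConcaveOn_log_Ioi.concaveOn.2 (x := a / μ) (y := b / μ)
    (Set.mem_Ioi.mpr (by positivity)) (Set.mem_Ioi.mpr (by positivity))
    (sub_nonneg.mpr ht1) ht0 (by ring)
  simp only [smul_eq_mul] at h
  rwa [show ((1 - t) * a + t * b) / μ = (1 - t) * (a / μ) + t * (b / μ) by ring]

lemma sq_comb {n : ℕ} (x x' w w' : Vec n) (t : ℝ) :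
    (∑ j, (((1 - t) • x + t • x') j - w j) ^ 2) + ∑ j, (((1 - t) • x' + t • x) j - w' j) ^ 2
      = (∑ j, (x j - w j) ^ 2) + (∑ j, (x' j - w' j) ^ 2)
        + 2 * t * (∑ j, (x' j - x j) * (w' j - w j)) + (2 * t ^ 2 - 2 * t) * ∑ j, (x' j - x j) ^ 2 := by
  simp only [Finset.mul_sum, ← Finset.sum_add_distrib]
  refine Finset.sum_congr rfl fun j _ => ?_
  simp only [Pi.add_apply, Pi.smul_apply, smul_eq_mul]
  ring

lemma LMEData.key_ineq (D : LMEData m p q) (hn : ∀ i, 0 < D.n i)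
    (hlam : ∀ i, (D.lam i).PosDef) {μ η : ℝ} (hμ : 0 < μ)
    {x x' w w' : Vec p × Vec q}
    (hx : ∀ z : Vec p × Vec q, D.Lrelax η μ x w ≤ D.Lrelax η μ z w)
    (hx' : ∀ z : Vec p × Vec q, D.Lrelax η μ x' w' ≤ D.Lrelax η μ z w')
    {t : ℝ} (ht0 : 0 < t) (ht1 : t ≤ 1) :
    0 ≤ t * (D.etabar * (∑ j, (x'.2 j - x.2 j) ^ 2) - η * sqnorm2 (x' - x)
      + η * ((∑ j, (x'.1 j - x.1 j) * (w'.1 j - w.1 j))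
        + ∑ j, (x'.2 j - x.2 j) * (w'.2 j - w.2 j))) + t ^ 2 * (η * sqnorm2 (x' - x)) := by
  have px := D.S_pos hμ hx
  have px' := D.S_pos hμ hx'
  have hc : ∀ (a b : Vec q), (∀ j, 0 < a j) → (∀ j, 0 < b j) →
      ∀ j, 0 < ((1 - t) • a + t • b) j := by
    intro a b ha hb j
    exact add_pos_of_nonneg_of_pos (mul_nonneg (sub_nonneg.mpr ht1) (ha j).le)
      (mul_pos ht0 (hb j))
  have h1 := hx ((1 - t) • x.1 + t • x'.1, (1 - t) • x.2 + t • x'.2)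
  have h2 := hx' ((1 - t) • x'.1 + t • x.1, (1 - t) • x'.2 + t • x.2)
  rw [D.Lrelax_eq hμ px, D.Lrelax_eq hμ (hc _ _ px px'), EReal.coe_le_coe_iff] at h1
  rw [D.Lrelax_eq hμ px', D.Lrelax_eq hμ (hc _ _ px' px), EReal.coe_le_coe_iff] at h2
  have h3 := D.L_semiconvex hn hlam x.1 x'.1 (fun j => (px j).le) (fun j => (px' j).le) ht0.le ht1
  have h4 : ∀ a b : Vec q, (∀ j, 0 < a j) → (∀ j, 0 < b j) →
      (1 - t) * (∑ j, Real.log (a j / μ)) + t * (∑ j, Real.log (b j / μ))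
        ≤ ∑ j, Real.log (((1 - t) • a + t • b) j / μ) := by
    intro a b ha hb
    rw [Finset.mul_sum, Finset.mul_sum, ← Finset.sum_add_distrib]
    exact Finset.sum_le_sum fun j _ => log_div_concave hμ (ha j) (hb j) ht0.le ht1
  have h5 := mul_le_mul_of_nonneg_left (h4 _ _ px px') hμ.le
  have h6 := mul_le_mul_of_nonneg_left (h4 _ _ px' px) hμ.le
  have c1 := sq_comb x.1 x'.1 w.1 w'.1 t
  have c2 := sq_comb x.2 x'.2 w.2 w'.2 t
  simp only [kappaFun, sqnorm2, Prod.fst_sub, Prod.snd_sub, Pi.sub_apply] at h1 h2 ⊢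
  have c1' := congrArg (fun s => η / 2 * s) c1
  have c2' := congrArg (fun s => η / 2 * s) c2
  linarith

lemma LMEData.S_lip (D : LMEData m p q) (hn : ∀ i, 0 < D.n i)
    (hlam : ∀ i, (D.lam i).PosDef) {μ η : ℝ} (hμ : 0 < μ) (hη : D.etabar < η)
    {x x' w w' : Vec p × Vec q}
    (hx : ∀ z : Vec p × Vec q, D.Lrelax η μ x w ≤ D.Lrelax η μ z w)
    (hx' : ∀ z : Vec p × Vec q, D.Lrelax η μ x' w' ≤ D.Lrelax η μ z w') :
    (η - D.etabar) ^ 2 * sqnorm2 (x' - x) ≤ η ^ 2 * sqnorm2 (w' - w) := by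
  have he := D.etabar_nonneg
  set A := D.etabar * (∑ j, (x'.2 j - x.2 j) ^ 2) - η * sqnorm2 (x' - x)
      + η * ((∑ j, (x'.1 j - x.1 j) * (w'.1 j - w.1 j))
        + ∑ j, (x'.2 j - x.2 j) * (w'.2 j - w.2 j)) with hA
  set B := η * sqnorm2 (x' - x) with hB
  have hk : ∀ t : ℝ, 0 < t → t ≤ 1 → 0 ≤ A + t * B := by
    intro t h0 h1
    have := D.key_ineq hn hlam hμ hx hx' h0 h1
    rw [← hB, ← hA, show t * A + t ^ 2 * B = t * (A + t * B) by ring] at this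
    exact (mul_nonneg_iff_of_pos_left h0).mp this
  have hA0 : 0 ≤ A := by
    have ht : Tendsto (fun t : ℝ => A + t * B) (𝓝[>] 0) (𝓝 (A + 0 * B)) :=
      ((by fun_prop : Continuous fun t : ℝ => A + t * B).tendsto 0).mono_left nhdsWithin_le_nhds
    rw [zero_mul, add_zero] at ht
    refine ge_of_tendsto ht ?_
    filter_upwards [Ioc_mem_nhdsGT (zero_lt_one (α := ℝ))] with t ht
    exact hk t ht.1 ht.2
  have hs : (∑ j, (x'.2 j - x.2 j) ^ 2) ≤ sqnorm2 (x' - x) := by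
    simp only [sqnorm2, Prod.fst_sub, Prod.snd_sub, Pi.sub_apply]
    have : 0 ≤ ∑ j, (x'.1 j - x.1 j) ^ 2 := Finset.sum_nonneg fun j _ => sq_nonneg _
    linarith
  set c := η - D.etabar with hcdef
  have hc : 0 < c := sub_pos.mpr hη
  set I := (∑ j, (x'.1 j - x.1 j) * (w'.1 j - w.1 j))
        + ∑ j, (x'.2 j - x.2 j) * (w'.2 j - w.2 j) with hI
  have h1 : c * sqnorm2 (x' - x) ≤ η * I := by
    have := mul_le_mul_of_nonneg_left hs he
    rw [hcdef]; linarith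
  have h2 : 0 ≤ c ^ 2 * sqnorm2 (x' - x) - 2 * c * η * I + η ^ 2 * sqnorm2 (w' - w) := by
    have e : c ^ 2 * sqnorm2 (x' - x) - 2 * c * η * I + η ^ 2 * sqnorm2 (w' - w)
      = (∑ j, (c * (x'.1 j - x.1 j) - η * (w'.1 j - w.1 j)) ^ 2)
        + ∑ j, (c * (x'.2 j - x.2 j) - η * (w'.2 j - w.2 j)) ^ 2 := by
      have hh : ∀ {n : ℕ} (a b : Vec n), ∑ j, (c * a j - η * b j) ^ 2
          = c ^ 2 * (∑ j, a j ^ 2) - 2 * c * η * (∑ j, a j * b j) + η ^ 2 * ∑ j, b j ^ 2 := by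
        intro n a b
        simp only [Finset.mul_sum, ← Finset.sum_add_distrib, ← Finset.sum_sub_distrib]
        exact Finset.sum_congr rfl fun j _ => by ring
      have e1 := hh (x'.1 - x.1) (w'.1 - w.1)
      have e2 := hh (x'.2 - x.2) (w'.2 - w.2)
      simp only [Pi.sub_apply] at e1 e2
      rw [e1, e2, hI]
      simp only [sqnorm2, Prod.fst_sub, Prod.snd_sub, Pi.sub_apply]
      ring
    rw [e]
    positivity
  nlinarith [mul_le_mul_of_nonneg_left h1 hc.le]

lemma sqnorm2_nonneg (w : Vec p × Vec q) : 0 ≤ sqnorm2 w := by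
  unfold sqnorm2; positivity

lemma sqnorm2_smul (c : ℝ) (w : Vec p × Vec q) : sqnorm2 (c • w) = c ^ 2 * sqnorm2 w := by
  simp [sqnorm2, mul_add, Finset.mul_sum, mul_pow]

lemma fderiv_bound (S : Vec p × Vec q → Vec p × Vec q) {K : ℝ} (hK : 0 ≤ K)
    (h : ∀ w w', sqnorm2 (S w' - S w) ≤ K ^ 2 * sqnorm2 (w' - w)) (w dw : Vec p × Vec q) :
    Real.sqrt (sqnorm2 ((fderiv ℝ S w) dw)) ≤ K * Real.sqrt (sqnorm2 dw) := by
  rw [← Real.sqrt_sq hK, ← Real.sqrt_mul (sq_nonneg K)]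
  apply Real.sqrt_le_sqrt
  by_cases hd : DifferentiableAt ℝ S w
  · have ht := (hd.hasFDerivAt.hasLineDerivAt dw).tendsto_slope_zero_right
    have hcont : Continuous (sqnorm2 : Vec p × Vec q → ℝ) := by
      unfold sqnorm2; fun_prop
    refine le_of_tendsto ((hcont.tendsto _).comp ht) ?_
    filter_upwards [self_mem_nhdsWithin] with t ht
    have ht' : (0 : ℝ) < t := ht
    simp only [Function.comp]
    have := h w (w + t • dw)
    rw [add_sub_cancel_left, sqnorm2_smul] at this
    rw [sqnorm2_smul]
    calc _ ≤ t⁻¹ ^ 2 * (K ^ 2 * (t ^ 2 * sqnorm2 dw)) := by gcongr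
      _ = _ := by field_simp
  · rw [fderiv_zero_of_not_differentiableAt hd]
    have : sqnorm2 ((0 : (Vec p × Vec q) →L[ℝ] (Vec p × Vec q)) dw) = 0 := by simp [sqnorm2]
    rw [this]
    exact mul_nonneg (sq_nonneg _) (sqnorm2_nonneg _)

end Lipschitz

section Calculus

variable {m p q : ℕ}

lemma clm_sum {n : ℕ} (f : Vec n →L[ℝ] ℝ) (v : Vec n) :
    ∑ k, f (Pi.single k 1) * v k = f v := by
  have := LinearMap.pi_apply_eq_sum_univ (f : Vec n →ₗ[ℝ] ℝ) v
  simp only [ContinuousLinearMap.coe_coe, smul_eq_mul] at this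
  rw [this]
  refine Finset.sum_congr rfl fun k _ => ?_
  rw [mul_comm]
  congr 2
  ext j
  simp [Pi.single_apply, eq_comm]

lemma fderiv_of_line {n : ℕ} {f : Vec n → ℝ} {x v : Vec n} (hf : DifferentiableAt ℝ f x)
    {c : ℝ} (h : HasDerivAt (fun t : ℝ => f (x + t • v)) c 0) : fderiv ℝ f x v = c :=
  HasDerivAt.unique (hf.hasFDerivAt.hasLineDerivAt v) h

lemma LMEData.omega_symm (D : LMEData m p q) (hlam : ∀ i, (D.lam i).PosDef) (g : Vec q)
    (i : Fin m) : ((D.Omega (diagonal g) i)⁻¹)ᵀ = (D.Omega (diagonal g) i)⁻¹ := by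
  have hs : (D.lam i)ᵀ = D.lam i := by
    have := (hlam i).1.eq
    rwa [conjTranspose_eq_transpose_of_trivial] at this
  rw [transpose_nonsing_inv]
  congr 1
  simp [LMEData.Omega, transpose_mul, Matrix.mul_assoc, hs]

lemma hasDerivAt_lin0 (a b : ℝ) : HasDerivAt (fun t : ℝ => a + t * b) b 0 := by
  have h := ((hasDerivAt_id' (0 : ℝ)).mul_const b).const_add a
  rwa [one_mul] at h

lemma hasDerivAt_quad0 (a b c : ℝ) :
    HasDerivAt (fun t : ℝ => a + t * b + t ^ 2 * c) b 0 := by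
  have h := (hasDerivAt_lin0 a b).fun_add (((hasDerivAt_id' (0 : ℝ)).fun_pow 2).mul_const c)
  have e : b + ((2 : ℕ) : ℝ) * (0 : ℝ) ^ (2 - 1) * 1 * c = b := by norm_num
  rwa [e] at h

lemma LMEData.gradB_eq (D : LMEData m p q) (hlam : ∀ i, (D.lam i).PosDef) (b : Vec p) (g : Vec q)
    (j : Fin p) : D.gradB b g j
      = ∑ i, - ((D.X i *ᵥ Pi.single j 1) ⬝ᵥ ((D.Omega (diagonal g) i)⁻¹ *ᵥ (D.y i - D.X i *ᵥ b))) := by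
  unfold LMEData.gradB
  apply fderiv_of_line
  · unfold LMEData.L LMEData.LML
    simp only [dotProduct, mulVec, Pi.sub_apply]
    fun_prop
  · unfold LMEData.L LMEData.LML
    apply HasDerivAt.fun_sum
    intro i _
    set e := Pi.single (M := fun _ => ℝ) j (1 : ℝ)
    set A := (D.Omega (diagonal g) i)⁻¹ with hA
    have hs : Aᵀ = A := D.omega_symm hlam g i
    set r := D.y i - D.X i *ᵥ b with hr
    have e1 : ∀ t : ℝ, D.y i - D.X i *ᵥ (b + t • e) = r - t • (D.X i *ᵥ e) := by
      intro t
      rw [mulVec_add, mulVec_smul, hr]; abel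
    have e2 : ∀ t : ℝ, (1 : ℝ) / 2 * ((D.y i - D.X i *ᵥ (b + t • e)) ⬝ᵥ
          (A *ᵥ (D.y i - D.X i *ᵥ (b + t • e))))
        + (1 : ℝ) / 2 * Real.log (D.Omega (diagonal g) i).det
        = ((1 : ℝ) / 2 * (r ⬝ᵥ A *ᵥ r) + (1 : ℝ) / 2 * Real.log (D.Omega (diagonal g) i).det)
          + t * (-((D.X i *ᵥ e) ⬝ᵥ A *ᵥ r)) + t ^ 2 * (1 / 2 * ((D.X i *ᵥ e) ⬝ᵥ A *ᵥ (D.X i *ᵥ e))) := by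
      intro t
      rw [e1]
      simp only [mulVec_sub, mulVec_smul, dotProduct_sub, sub_dotProduct, smul_dotProduct,
        dotProduct_smul, smul_eq_mul]
      rw [symm_dot hs r (D.X i *ᵥ e)]
      ring
    simp only [e2]
    exact hasDerivAt_quad0 _ _ _

lemma LMEData.hessBB_eq (D : LMEData m p q) (hlam : ∀ i, (D.lam i).PosDef) (b : Vec p)
    (g : Vec q) : D.hessBB b g = ∑ i, (D.X i)ᵀ * (D.Omega (diagonal g) i)⁻¹ * D.X i := by
  ext j k
  unfold LMEData.hessBB
  rw [of_apply]
  simp only [D.gradB_eq hlam]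
  rw [Matrix.sum_apply]
  apply fderiv_of_line
  · simp only [dotProduct, mulVec, Pi.sub_apply]
    fun_prop
  · apply HasDerivAt.fun_sum
    intro i _
    have e1 : ∀ t : ℝ, -((D.X i *ᵥ Pi.single j 1) ⬝ᵥ ((D.Omega (diagonal g) i)⁻¹ *ᵥ
          (D.y i - D.X i *ᵥ (b + t • Pi.single k 1))))
        = -((D.X i *ᵥ Pi.single j 1) ⬝ᵥ ((D.Omega (diagonal g) i)⁻¹ *ᵥ (D.y i - D.X i *ᵥ b)))
          + t * ((D.X i)ᵀ * (D.Omega (diagonal g) i)⁻¹ * D.X i) j k := by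
      intro t
      have e3 : ((D.X i)ᵀ * (D.Omega (diagonal g) i)⁻¹ * D.X i) j k
          = (D.X i *ᵥ Pi.single j 1) ⬝ᵥ ((D.Omega (diagonal g) i)⁻¹ *ᵥ (D.X i *ᵥ Pi.single k 1)) := by
        rw [← vecMul_transpose, ← dotProduct_mulVec, mulVec_mulVec, mulVec_mulVec,
          single_one_dotProduct, mulVec_single_one, Matrix.mul_assoc]
        rfl
      rw [e3, mulVec_add, mulVec_smul, ← sub_sub, mulVec_sub, mulVec_smul, dotProduct_sub,
        dotProduct_smul, smul_eq_mul]
      ring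
    simp only [e1]
    exact hasDerivAt_lin0 _ _

lemma inv_fderiv {ι κ : Type*} [Fintype ι] [Fintype κ] [DecidableEq ι] [DecidableEq κ]
    (Λ : Matrix ι ι ℝ) (Z : Matrix ι κ ℝ) (g : κ → ℝ)
    (hu : IsUnit (Z * diagonal g * Zᵀ + Λ)) (u r : ι → ℝ) :
    ∃ f' : (κ → ℝ) →L[ℝ] ℝ,
      HasFDerivAt (fun g : κ → ℝ => u ⬝ᵥ (Z * diagonal g * Zᵀ + Λ)⁻¹ *ᵥ r) f' g ∧
      ∀ v, f' v = - (u ⬝ᵥ ((Z * diagonal g * Zᵀ + Λ)⁻¹ *ᵥ (Z *ᵥ (diagonal v *ᵥ (Zᵀ *ᵥ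
        ((Z * diagonal g * Zᵀ + Λ)⁻¹ *ᵥ r)))))) := by
  letI := Matrix.linftyOpNormedRing (n := ι) (α := ℝ)
  letI := Matrix.linftyOpNormedAlgebra (n := ι) (R := ℝ) (α := ℝ)
  haveI : CompleteSpace (Matrix ι ι ℝ) := FiniteDimensional.complete ℝ _
  let A : (κ → ℝ) →ₗ[ℝ] Matrix ι ι ℝ :=
    { toFun := fun g => Z * diagonal g * Zᵀ
      map_add' := fun a b => by
        have e : diagonal (a + b) = diagonal a + diagonal b := by rw [diagonal_add]; rfl
        rw [e, Matrix.mul_add, Matrix.add_mul]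
      map_smul' := fun c a => by
        rw [diagonal_smul, Matrix.mul_smul, Matrix.smul_mul]; rfl }
  let F : Matrix ι ι ℝ →ₗ[ℝ] ℝ :=
    { toFun := fun M => u ⬝ᵥ M *ᵥ r
      map_add' := fun a b => by rw [add_mulVec, dotProduct_add]
      map_smul' := fun c a => by rw [smul_mulVec, dotProduct_smul]; rfl }
  obtain ⟨U, hU⟩ := hu
  have h1 : HasFDerivAt (fun g => Z * diagonal g * Zᵀ + Λ) (LinearMap.toContinuousLinearMap A) g :=
    ((LinearMap.toContinuousLinearMap A).hasFDerivAt (x := g)).add_const Λ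
  have h2 := hasFDerivAt_ringInverse (𝕜 := ℝ) U
  rw [hU] at h2
  have h3 := h2.comp g h1
  have h4 := ((LinearMap.toContinuousLinearMap F).hasFDerivAt).comp g h3
  refine ⟨_, h4.congr_of_eventuallyEq (Eventually.of_forall fun x => ?_), ?_⟩
  · simp only [Function.comp, ← nonsing_inv_eq_ringInverse]
    rfl
  · intro v
    have hUi : (↑U⁻¹ : Matrix ι ι ℝ) = (Z * diagonal g * Zᵀ + Λ)⁻¹ := by
      rw [← hU, coe_units_inv]
    change u ⬝ᵥ (-((↑U⁻¹ : Matrix ι ι ℝ) * (Z * diagonal v * Zᵀ) * (↑U⁻¹ : Matrix ι ι ℝ))) *ᵥ r = _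
    rw [hUi, neg_mulVec, dotProduct_neg]
    simp only [mulVec_mulVec, Matrix.mul_assoc]

lemma LMEData.hessGB_mulVec (D : LMEData m p q) (hlam : ∀ i, (D.lam i).PosDef) (b : Vec p)
    (g : Vec q) (hg : ∀ j, 0 ≤ g j) (v : Vec q) (j : Fin p) :
    (D.hessGB b g *ᵥ v) j = ∑ i, (D.X i *ᵥ Pi.single j 1) ⬝ᵥ
      ((D.Omega (diagonal g) i)⁻¹ *ᵥ (D.Z i *ᵥ (diagonal v *ᵥ ((D.Z i)ᵀ *ᵥ
        ((D.Omega (diagonal g) i)⁻¹ *ᵥ (D.y i - D.X i *ᵥ b)))))) := by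
  have h0 : (D.hessGB b g *ᵥ v) j = fderiv ℝ (fun g => D.gradB b g j) g v := by
    rw [← clm_sum]; rfl
  rw [h0]
  simp only [D.gradB_eq hlam]
  have h1 := fun i => inv_fderiv (D.lam i) (D.Z i) g (omega_posdef (hlam i) (D.Z i) hg).isUnit
    (D.X i *ᵥ Pi.single j 1) (D.y i - D.X i *ᵥ b)
  choose f' hf hf' using h1
  have h2 := (HasFDerivAt.fun_sum (u := Finset.univ) fun i _ => (hf i).fun_neg).fderiv
  have h3 := congrArg (fun T => T v) h2
  refine h3.trans ?_
  simp only [ContinuousLinearMap.sum_apply, ContinuousLinearMap.neg_apply, hf', neg_neg]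
  rfl

end Calculus

section Stack

variable {m : ℕ} {n n' : Fin m → ℕ}

lemma eNorm_stack (x : (i : Fin m) × Fin (n i) → ℝ) :
    eNorm x ^ 2 = ∑ i, eNorm (fun k => x ⟨i, k⟩) ^ 2 := by
  simp only [eNorm_sq', Fintype.sum_sigma]

lemma bd_mulVec (M : ∀ i, Matrix (Fin (n i)) (Fin (n' i)) ℝ) (x : (i : Fin m) × Fin (n' i) → ℝ)
    (i : Fin m) (a : Fin (n i)) :
    (blockDiagonal' M *ᵥ x) ⟨i, a⟩ = (M i *ᵥ fun k => x ⟨i, k⟩) a := by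
  rw [mulVec, dotProduct, Fintype.sum_sigma, Finset.sum_eq_single i]
  · simp only [blockDiagonal'_apply_eq]; rfl
  · intro b _ hb
    exact Finset.sum_eq_zero fun k _ => by rw [blockDiagonal'_apply_ne _ _ _ hb.symm, zero_mul]
  · simp

lemma eNorm_zero {ι : Type*} [Fintype ι] : eNorm (0 : ι → ℝ) = 0 := by simp [eNorm]

lemma eNorm_ext (i : Fin m) (x : Fin (n i) → ℝ) :
    eNorm (fun s : (i : Fin m) × Fin (n i) => (Pi.single i x : ∀ i, Fin (n i) → ℝ) s.1 s.2) ^ 2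
      = eNorm x ^ 2 := by
  rw [eNorm_stack, Finset.sum_eq_single i]
  · simp
  · intro b _ hb
    simp only [Pi.single_eq_of_ne hb]
    have := eNorm_zero (ι := Fin (n b))
    change eNorm (0 : Fin (n b) → ℝ) ^ 2 = 0
    rw [this]; norm_num
  · simp

lemma opNorm_block_le (M : ∀ i, Matrix (Fin (n i)) (Fin (n' i)) ℝ) (i : Fin m) :
    opNorm (M i) ≤ opNorm (blockDiagonal' M) := by
  refine opNorm_le _ (opNorm_nonneg _) fun x => ?_
  have h := le_opNorm (blockDiagonal' M)
    (fun s => (Pi.single i x : ∀ i, Fin (n' i) → ℝ) s.1 s.2)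
  have hx : eNorm (fun s : (i : Fin m) × Fin (n' i) =>
      (Pi.single i x : ∀ i, Fin (n' i) → ℝ) s.1 s.2) = eNorm x :=
    (sq_eq_sq₀ (eNorm_nonneg _) (eNorm_nonneg _)).mp (eNorm_ext i x)
  rw [hx] at h
  refine le_trans ?_ h
  apply le_of_sq_le_sq _ (eNorm_nonneg _)
  rw [eNorm_stack]
  have h2 := Finset.single_le_sum (f := fun i' => eNorm (fun k => (blockDiagonal' M *ᵥ
    (fun s => (Pi.single i x : ∀ i, Fin (n' i) → ℝ) s.1 s.2)) ⟨i', k⟩) ^ 2)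
    (fun i' _ => sq_nonneg _) (Finset.mem_univ i)
  refine le_trans (le_of_eq ?_) h2
  simp only [bd_mulVec, Pi.single_eq_same]

lemma bd_quad (M : ∀ i, Matrix (Fin (n i)) (Fin (n i)) ℝ) (x : (i : Fin m) × Fin (n i) → ℝ) :
    x ⬝ᵥ blockDiagonal' M *ᵥ x = ∑ i, (fun k => x ⟨i, k⟩) ⬝ᵥ M i *ᵥ (fun k => x ⟨i, k⟩) := by
  rw [dotProduct, Fintype.sum_sigma]
  simp only [bd_mulVec]
  rfl

lemma bd_posDef (M : ∀ i, Matrix (Fin (n i)) (Fin (n i)) ℝ) (h : ∀ i, (M i).PosDef) :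
    (blockDiagonal' M).PosDef := by
  refine PosDef.of_dotProduct_mulVec_pos ?_ fun x hx => ?_
  · rw [Matrix.IsHermitian, blockDiagonal'_conjTranspose]
    congr 1
    ext1 i
    exact (h i).1
  · rw [star_trivial, bd_quad]
    obtain ⟨⟨i, k⟩, hik⟩ := Function.ne_iff.mp hx
    refine Finset.sum_pos' (fun i _ => posdef_dot_nonneg (h i).posSemidef _) ⟨i, Finset.mem_univ _, ?_⟩
    have hne : (fun k => x ⟨i, k⟩) ≠ 0 := fun h0 => hik (congrFun h0 k)
    simpa using (h i).dotProduct_mulVec_pos hne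

lemma minEig_block (M : ∀ i, Matrix (Fin (n i)) (Fin (n i)) ℝ) (h : ∀ i, (M i).PosDef)
    (i : Fin m) (x : Fin (n i) → ℝ) :
    minEig (blockDiagonal' M) * eNorm x ^ 2 ≤ x ⬝ᵥ M i *ᵥ x := by
  have h1 := minEig_le (bd_posDef M h).posSemidef
    (fun s => (Pi.single i x : ∀ i, Fin (n i) → ℝ) s.1 s.2)
  rw [eNorm_ext, bd_quad, Finset.sum_eq_single i] at h1
  · simpa using h1
  · intro b _ hb
    simp only [Pi.single_eq_of_ne hb]
    exact zero_dotProduct _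
  · simp

lemma eNorm_diag_le {q : ℕ} (v a : Vec q) : eNorm (diagonal v *ᵥ a) ≤ eNorm v * eNorm a := by
  apply le_of_sq_le_sq _ (mul_nonneg (eNorm_nonneg _) (eNorm_nonneg _))
  rw [mul_pow, eNorm_sq', eNorm_sq', eNorm_sq', Finset.mul_sum]
  refine Finset.sum_le_sum fun j _ => ?_
  rw [mulVec_diagonal, mul_pow]
  gcongr
  exact Finset.single_le_sum (f := fun j => v j ^ 2) (fun j _ => sq_nonneg _) (Finset.mem_univ j)

end Stack

lemma LMEData.K_bound {m p q : ℕ} (hm : 0 < m) (D : LMEData m p q) (hn : ∀ i, 0 < D.n i)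
    (hlam : ∀ i, (D.lam i).PosDef) {η : ℝ} (hη : 0 < η) (b : Vec p) (g : Vec q)
    (hg : ∀ j, 0 ≤ g j) :
    opNorm ((D.hessBB b g + η • (1 : Matrix (Fin p) (Fin p) ℝ))⁻¹ * D.hessGB b g)
      ≤ η⁻¹ * ((minEig (Matrix.blockDiagonal' D.lam)) ^ 2)⁻¹
          * opNorm (Matrix.of fun (r : (i : Fin m) × Fin (D.n i)) (j : Fin p) =>
              D.X r.1 r.2 j)
          * (opNorm (Matrix.blockDiagonal' D.Z)) ^ 2
          * eNorm ((Matrix.of fun (r : (i : Fin m) × Fin (D.n i)) (j : Fin p) =>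
                D.X r.1 r.2 j) *ᵥ b
              - fun r : (i : Fin m) × Fin (D.n i) => D.y r.1 r.2) := by
  set Xs := Matrix.of fun (r : (i : Fin m) × Fin (D.n i)) (j : Fin p) => D.X r.1 r.2 j with hXs
  set res := Xs *ᵥ b - fun r : (i : Fin m) × Fin (D.n i) => D.y r.1 r.2 with hres
  set l := minEig (Matrix.blockDiagonal' D.lam) with hl
  set σ := opNorm (Matrix.blockDiagonal' D.Z) with hσ
  have : Nonempty ((i : Fin m) × Fin (D.n i)) := ⟨⟨⟨0, hm⟩, ⟨0, hn _⟩⟩⟩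
  have hlpos : 0 < l := minEig_pos (bd_posDef D.lam hlam)
  have hσ0 : 0 ≤ σ := opNorm_nonneg _
  have hX0 := opNorm_nonneg Xs
  have hr0 := eNorm_nonneg res
  have hΩ : ∀ i, (D.Omega (diagonal g) i).PosDef := fun i => omega_posdef (hlam i) (D.Z i) hg
  have hΩl : ∀ i x, l * eNorm x ^ 2 ≤ x ⬝ᵥ D.Omega (diagonal g) i *ᵥ x := fun i x =>
    omega_lower (hlam i) (D.Z i) hg (minEig_block D.lam hlam i) x
  have hBB : (D.hessBB b g).PosSemidef := by
    rw [D.hessBB_eq hlam]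
    refine posSemidef_sum _ fun i _ => ?_
    have := (hΩ i).inv.posSemidef.conjTranspose_mul_mul_same (D.X i)
    rwa [conjTranspose_eq_transpose_of_trivial] at this
  have hH1 : (D.hessBB b g + η • (1 : Matrix (Fin p) (Fin p) ℝ)).PosDef :=
    PosDef.posSemidef_add hBB (PosDef.one.smul hη)
  have hH1l : ∀ x, η * eNorm x ^ 2 ≤ x ⬝ᵥ (D.hessBB b g + η • (1 : Matrix (Fin p) (Fin p) ℝ)) *ᵥ x := by
    intro x
    have := posdef_dot_nonneg hBB x
    rw [add_mulVec, smul_mulVec, one_mulVec, dotProduct_add, dotProduct_smul, ← eNorm_sq,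
      smul_eq_mul]
    linarith
  refine opNorm_le _ (by positivity) fun v => ?_
  rw [← mulVec_mulVec]
  refine (eNorm_inv_le hH1 hη hH1l _).trans ?_
  let a : ∀ i, Fin (D.n i) → ℝ := fun i => (D.Omega (diagonal g) i)⁻¹ *ᵥ (D.Z i *ᵥ (diagonal v *ᵥ
    ((D.Z i)ᵀ *ᵥ ((D.Omega (diagonal g) i)⁻¹ *ᵥ (D.y i - D.X i *ᵥ b)))))
  let as : (i : Fin m) × Fin (D.n i) → ℝ := fun s => a s.1 s.2
  have hC : D.hessGB b g *ᵥ v = Xsᵀ *ᵥ as := by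
    ext j
    rw [D.hessGB_mulVec hlam b g hg v j, mulVec, dotProduct, Fintype.sum_sigma]
    refine Finset.sum_congr rfl fun i _ => ?_
    rw [mulVec_single_one]
    rfl
  have hai : ∀ i, eNorm (a i) ≤ (l ^ 2)⁻¹ * σ ^ 2 * eNorm v * eNorm (fun k => res ⟨i, k⟩) := by
    intro i
    have hri : eNorm (D.y i - D.X i *ᵥ b) = eNorm (fun k => res ⟨i, k⟩) := by
      have : (fun k => res ⟨i, k⟩) = (-1 : ℝ) • (D.y i - D.X i *ᵥ b) := by
        ext k
        simp only [hres, Pi.sub_apply, Pi.smul_apply, smul_eq_mul]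
        have : (Xs *ᵥ b) ⟨i, k⟩ = (D.X i *ᵥ b) k := rfl
        rw [this]; ring
      rw [this, eNorm_smul]; simp
    have hZi := opNorm_block_le D.Z i
    have hv := eNorm_nonneg v
    calc eNorm (a i) ≤ l⁻¹ * _ := eNorm_inv_le (hΩ i) hlpos (hΩl i) _
      _ ≤ l⁻¹ * (σ * _) := by
          gcongr
          exact (le_opNorm _ _).trans (mul_le_mul_of_nonneg_right hZi (eNorm_nonneg _))
      _ ≤ l⁻¹ * (σ * (eNorm v * _)) := by gcongr; exact eNorm_diag_le _ _
      _ ≤ l⁻¹ * (σ * (eNorm v * (σ * _))) := by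
          gcongr
          exact (le_opNorm_transpose _ _).trans (mul_le_mul_of_nonneg_right hZi (eNorm_nonneg _))
      _ ≤ l⁻¹ * (σ * (eNorm v * (σ * (l⁻¹ * eNorm (D.y i - D.X i *ᵥ b))))) := by
          gcongr; exact eNorm_inv_le (hΩ i) hlpos (hΩl i) _
      _ = _ := by rw [hri]; ring
  have hv := eNorm_nonneg v
  have has : eNorm as ≤ (l ^ 2)⁻¹ * σ ^ 2 * eNorm v * eNorm res := by
    apply le_of_sq_le_sq _ (by positivity)
    rw [eNorm_stack, mul_pow, eNorm_stack res, Finset.mul_sum]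
    refine Finset.sum_le_sum fun i _ => ?_
    rw [← mul_pow]
    exact pow_le_pow_left₀ (eNorm_nonneg _) (hai i) 2
  rw [hC]
  calc _ ≤ η⁻¹ * (opNorm Xs * eNorm as) := by gcongr; exact le_opNorm_transpose _ _
    _ ≤ η⁻¹ * (opNorm Xs * ((l ^ 2)⁻¹ * σ ^ 2 * eNorm v * eNorm res)) := by gcongr
    _ = _ := by ring

/-- bound on the Jacobian of the solution mapping:
‖∇S_{η,μ}(β̃,γ̃)‖ ≤ (η/(η−η̄))(1 + ‖H₁⁻¹C‖²) and
‖H₁⁻¹C‖ ≤ η⁻¹ μ_min(Λ)⁻² σ_max(X) σ_max(Z)² ‖Xβ̂ − y‖ for the stacked data. -/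
theorem solution_map_jacobian_bound
    {m p q : ℕ} (hm : 0 < m) (hp : 0 < p) (hq : 0 < q)
    (D : LMEData m p q) (hn : ∀ i, 0 < D.n i) (hlam : ∀ i, (D.lam i).PosDef)
    (μ η : ℝ) (hμ : 0 < μ) (hη : D.etabar < η)
    (S : Vec p × Vec q → Vec p × Vec q)
    (hS : ∀ w x' : Vec p × Vec q, D.Lrelax η μ (S w) w ≤ D.Lrelax η μ x' w)
    (w : Vec p × Vec q) :
    (∀ dw : Vec p × Vec q,
      Real.sqrt (sqnorm2 ((fderiv ℝ S w) dw))
        ≤ η / (η - D.etabar)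
            * (1 + (opNorm
                ((D.hessBB (S w).1 (S w).2 + η • (1 : Matrix (Fin p) (Fin p) ℝ))⁻¹
                  * D.hessGB (S w).1 (S w).2)) ^ 2)
            * Real.sqrt (sqnorm2 dw)) ∧
    opNorm ((D.hessBB (S w).1 (S w).2 + η • (1 : Matrix (Fin p) (Fin p) ℝ))⁻¹
        * D.hessGB (S w).1 (S w).2)
      ≤ η⁻¹ * ((minEig (Matrix.blockDiagonal' D.lam)) ^ 2)⁻¹
          * opNorm (Matrix.of fun (r : (i : Fin m) × Fin (D.n i)) (j : Fin p) =>
              D.X r.1 r.2 j)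
          * (opNorm (Matrix.blockDiagonal' D.Z)) ^ 2
          * eNorm ((Matrix.of fun (r : (i : Fin m) × Fin (D.n i)) (j : Fin p) =>
                D.X r.1 r.2 j) *ᵥ (S w).1
              - fun r : (i : Fin m) × Fin (D.n i) => D.y r.1 r.2) := by
  have he := D.etabar_nonneg
  have hη0 : 0 < η := lt_of_le_of_lt he hη
  have hc : 0 < η - D.etabar := sub_pos.mpr hη
  refine ⟨fun dw => ?_, D.K_bound hm hn hlam hη0 _ _ fun j => (D.S_pos hμ (hS w) j).le⟩
  have hK : 0 ≤ η / (η - D.etabar) := by positivity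
  refine (fderiv_bound S hK (fun w w' => ?_) w dw).trans ?_
  · have h := D.S_lip hn hlam hμ hη (hS w) (hS w')
    rw [div_pow, div_mul_eq_mul_div, le_div_iff₀ (by positivity)]
    linarith
  · refine mul_le_mul_of_nonneg_right ?_ (Real.sqrt_nonneg _)
    refine le_mul_of_one_le_right hK ?_
    nlinarith [sq_nonneg (opNorm ((D.hessBB (S w).1 (S w).2 + η • (1 : Matrix (Fin p) (Fin p) ℝ))⁻¹
      * D.hessGB (S w).1 (S w).2))]
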